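/- Let σ₁, …, σ_k : D → ℤ be continuous functions which generate C(D, ℤ) as a right ℤ[F]-module, and for each j fix a finite nonempty subtree X_j of T on which σ_j is supported. Let p : (ℤ[F])^k → C(D, ℤ) be the ℤ[F]-module homomorphism sending the j-th standard basis vector e_j to σ_j. For a nonzero element x = Σ_{j,g} n_{j,g} e_j · g of the free right ℤ[F]-module (ℤ[F])^k (with n_{j,g} ∈ ℤ almost all zero), define the support of x to be the convex hull in T of the union of the sets g⁻¹ · X_j over all pairs (j, g) with n_{j,g} ≠ 0. Then there exists N ∈ ℕ such that the kernel of p is generated as an abelian group by elements whose support has at most N vertices. -/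

import Mathlib

open scoped BigOperators

namespace DecompPaper

variable (B : Type) [DecidableEq B]

/-- The set of letters `B ⊔ B⁻¹` carries the discrete topology. -/
instance : TopologicalSpace (B × Bool) := ⊥

/-- The Gromov boundary `∂F` of the free group on `B`: the space of infinite reduced
words, i.e. sequences of letters with no cancelling adjacent pair, topologized as a
subspace of the product of discrete spaces. -/
abbrev Boundary : Type :=
  {s : ℕ → B × Bool // ∀ k, s (k + 1) ≠ ((s k).1, !(s k).2)}

/-- The prefix of length `m` of an infinite reduced word, as an element of the free group. -/
def prefixOf (ξ : Boundary B) (m : ℕ) : FreeGroup B :=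
  FreeGroup.mk (List.ofFn fun i : Fin m => ξ.1 i)

/-- Adjacency in the Cayley graph `T` of the free group with respect to `B`. -/
def Adj (g h : FreeGroup B) : Prop :=
  ∃ x : B × Bool, h = g * FreeGroup.mk [x]

/-- A set of vertices of `T` is a subtree iff any two of its vertices are joined by a
path in the Cayley graph staying inside the set. -/
def IsSubtree (X : Set (FreeGroup B)) : Prop :=
  ∀ g ∈ X, ∀ h ∈ X, Relation.ReflTransGen (fun a b => Adj B a b ∧ b ∈ X) g h

/-- `C` is a connected component of `T ∖ X`. -/
def IsComponentOf (X C : Set (FreeGroup B)) : Prop :=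
  ∃ v, v ∉ X ∧
    C = {u | Relation.ReflTransGen (fun a b => Adj B a b ∧ a ∉ X ∧ b ∉ X) v u}

/-- `∂C`: the set of boundary points all of whose sufficiently long prefixes lie in `C`. -/
def boundaryOf (C : Set (FreeGroup B)) : Set (Boundary B) :=
  {ξ | ∃ m, ∀ k, m ≤ k → prefixOf B ξ k ∈ C}

/-- The sequence `a` of group elements converges to the boundary point `ξ`:
every prefix of `ξ` is eventually an initial segment of the reduced word of `a k`. -/
def TendstoBoundary (a : ℕ → FreeGroup B) (ξ : Boundary B) : Prop :=
  ∀ m : ℕ, ∃ K, ∀ k, K ≤ k → (List.ofFn fun i : Fin m => ξ.1 i) <+: (a k).toWord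

/-- `{ξ, η}` is a line of the line pattern generated by the words `w i`: for some
`g` and `i`, `ξ` and `η` are the limits of `g * (w i) ^ k` as `k → +∞` and `k → -∞`
(in one of the two orders). -/
def IsLine {r : ℕ} (w : Fin r → FreeGroup B) (ξ η : Boundary B) : Prop :=
  ∃ (g : FreeGroup B) (i : Fin r),
    (TendstoBoundary B (fun k => g * w i ^ k) ξ ∧
       TendstoBoundary B (fun k => g * (w i)⁻¹ ^ k) η) ∨
    (TendstoBoundary B (fun k => g * w i ^ k) η ∧
       TendstoBoundary B (fun k => g * (w i)⁻¹ ^ k) ξ)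

/-- Malnormality of the family of cyclic subgroups `⟨w i⟩`. -/
def Malnormal {r : ℕ} (w : Fin r → FreeGroup B) : Prop :=
  ∀ (g : FreeGroup B) (i j : Fin r),
    (∃ x : FreeGroup B, x ∈ Subgroup.zpowers (w i) ∧ x ≠ 1 ∧
        g * x * g⁻¹ ∈ Subgroup.zpowers (w j)) →
      i = j ∧ g ∈ Subgroup.zpowers (w i)

/-- The decomposition space `D`: the quotient of `∂F` by the smallest equivalence
relation identifying the two endpoints of each line, with the quotient topology. -/
abbrev DSpace {r : ℕ} (w : Fin r → FreeGroup B) : Type :=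
  Quot (IsLine B w)

/-- The quotient projection `q : ∂F → D`. -/
def qmap {r : ℕ} (w : Fin r → FreeGroup B) : Boundary B → DSpace B w :=
  Quot.mk _

/-- The geodesic of the line with endpoints `ξ` and `η`: all prefixes of `ξ` or of `η`
of length at least the length of their longest common initial segment. -/
def lineGeodesic (ξ η : Boundary B) : Set (FreeGroup B) :=
  {g | ∃ k : ℕ, (g = prefixOf B ξ k ∨ g = prefixOf B η k) ∧ ∃ i ≤ k, ξ.1 i ≠ η.1 i}

/-- The line with endpoints `ξ, η` passes through the subtree `X`. -/
def PassesThrough (ξ η : Boundary B) (X : Set (FreeGroup B)) : Prop :=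
  ∃ g ∈ X, g ∈ lineGeodesic B ξ η

/-- A function `σ : D → ℤ` is supported on the subtree `X` if `σ ∘ q` is constant on
`∂C` for every connected component `C` of `T ∖ X`. -/
def SupportedOn {r : ℕ} (w : Fin r → FreeGroup B) (σ : DSpace B w → ℤ)
    (X : Set (FreeGroup B)) : Prop :=
  ∀ C : Set (FreeGroup B), IsComponentOf B X C →
    ∀ ξ, ξ ∈ boundaryOf B C → ∀ η, η ∈ boundaryOf B C →
      σ (qmap B w ξ) = σ (qmap B w η)

/-- Prepending a letter to an infinite reduced word, cancelling if necessary. -/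
def consB (x : B × Bool) (ξ : Boundary B) : Boundary B :=
  if h : ξ.1 0 = (x.1, !x.2) then
    ⟨fun k => ξ.1 (k + 1), fun k => ξ.2 (k + 1)⟩
  else
    ⟨fun k => Nat.rec x (fun j _ => ξ.1 j) k, by
      intro k
      cases k with
      | zero => exact h
      | succ j => exact ξ.2 j⟩

/-- The action of the free group on its boundary: left multiplication followed by
reduction. -/
def actB (g : FreeGroup B) (ξ : Boundary B) : Boundary B :=
  g.toWord.foldr (consB B) ξ

/-- The induced action of the free group on the decomposition space. -/
noncomputable def actD {r : ℕ} (w : Fin r → FreeGroup B) (g : FreeGroup B)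
    (x : DSpace B w) : DSpace B w :=
  qmap B w (actB B g (Quot.out x))

/-- The map `p : (ℤ[F])^k → C(D, ℤ)` of right `ℤ[F]`-modules determined by generators
`σ j`, where an element of the free module `(ℤ[F])^k` is recorded as a finitely
supported function `(Fin k × F) →₀ ℤ` and `e_j · g` is sent to `σ j · g`. -/
noncomputable def pMap {r : ℕ} (w : Fin r → FreeGroup B) {k : ℕ}
    (σ : Fin k → DSpace B w → ℤ) (x : (Fin k × FreeGroup B) →₀ ℤ) :
    DSpace B w → ℤ :=
  fun d => x.sum fun p n => n * σ p.1 (actD B w p.2 d)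

/-- Right translation by `g` on the free module `(ℤ[F])^k`, sending `e_j · h` to
`e_j · (h * g)`. -/
noncomputable def fsTranslate {k : ℕ} (y : (Fin k × FreeGroup B) →₀ ℤ)
    (g : FreeGroup B) : (Fin k × FreeGroup B) →₀ ℤ :=
  Finsupp.mapDomain (fun p => (p.1, p.2 * g)) y

/-- The convex hull of a set of vertices of `T`: the smallest subtree containing it. -/
def hull (S : Set (FreeGroup B)) : Set (FreeGroup B) :=
  ⋂₀ {Y : Set (FreeGroup B) | IsSubtree B Y ∧ S ⊆ Y}

/-- The support of an element of the free module `(ℤ[F])^k`, relative to supports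
`X j` of the generators: the convex hull of the union of the sets `g⁻¹ • X j` over
the pairs `(j, g)` appearing with nonzero coefficient. -/
def fsSupport {k : ℕ} (X : Fin k → Set (FreeGroup B))
    (x : (Fin k × FreeGroup B) →₀ ℤ) : Set (FreeGroup B) :=
  hull B (⋃ p ∈ x.support, (fun v => p.2⁻¹ * v) '' X p.1)

/-- Antisymmetry of a `1`-cochain on oriented lines. -/
def Antisym {r : ℕ} (w : Fin r → FreeGroup B)
    (f : Boundary B → Boundary B → ℤ) : Prop :=
  ∀ ξ η, IsLine B w ξ η → f η ξ = -f ξ η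

/-- A `1`-cochain is supported on the subtree `X`: it vanishes on lines not passing
through `X`, and depends only on the pair of components of `T ∖ X` containing the two
endpoints. -/
def SupportedOn1 {r : ℕ} (w : Fin r → FreeGroup B)
    (f : Boundary B → Boundary B → ℤ) (X : Set (FreeGroup B)) : Prop :=
  (∀ ξ η, IsLine B w ξ η → ¬PassesThrough B ξ η X → f ξ η = 0) ∧
  (∀ C C' : Set (FreeGroup B), IsComponentOf B X C → IsComponentOf B X C' → C ≠ C' →
    ∀ ξ ξ' η η', IsLine B w ξ η → IsLine B w ξ' η' →
      ξ ∈ boundaryOf B C → ξ' ∈ boundaryOf B C →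
      η ∈ boundaryOf B C' → η' ∈ boundaryOf B C' →
      f ξ η = f ξ' η')

/-- Membership in `C¹`: an antisymmetric integer-valued function on oriented lines
supported on at least one finite nonempty subtree of `T`. -/
def MemC1 {r : ℕ} (w : Fin r → FreeGroup B)
    (f : Boundary B → Boundary B → ℤ) : Prop :=
  Antisym B w f ∧
    ∃ X : Set (FreeGroup B), X.Finite ∧ X.Nonempty ∧ IsSubtree B X ∧
      SupportedOn1 B w f X

/-- The ball of radius `R` about a set `Y` of vertices of `T` (word metric). -/
def ballAbout (Y : Set (FreeGroup B)) (R : ℕ) : Set (FreeGroup B) :=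
  {g | ∃ y ∈ Y, (y⁻¹ * g).toWord.length ≤ R}

/-- The map `p : (ℤ[F])^k → C¹` of right `ℤ[F]`-modules determined by generators
`f j`, sending `e_j · g` to `f j · g`. -/
noncomputable def pC1 {k : ℕ} (f : Fin k → Boundary B → Boundary B → ℤ)
    (x : (Fin k × FreeGroup B) →₀ ℤ) : Boundary B → Boundary B → ℤ :=
  fun ξ η => x.sum fun p n => n * f p.1 (actB B p.2 ξ) (actB B p.2 η)

/-- `σ : ∂F → ℤ` is constant on `∂C` for every connected component `C` of `T ∖ X`. -/
def ConstOnComponents (X : Set (FreeGroup B)) (σ : Boundary B → ℤ) : Prop :=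
  ∀ C : Set (FreeGroup B), IsComponentOf B X C →
    ∀ ξ, ξ ∈ boundaryOf B C → ∀ η, η ∈ boundaryOf B C → σ ξ = σ η

/-- The shadow `S(g) ⊆ ∂F` of a nontrivial group element `g`: the boundary points
having the reduced word of `g` as an initial segment. -/
def shadow (g : FreeGroup B) : Set (Boundary B) :=
  {ξ | prefixOf B ξ g.toWord.length = g}

end DecompPaper

namespace DecompPaper

variable {B : Type} [DecidableEq B]

section Words

theorem ne_flip_iff {α : Type*} {x y : α × Bool} : y ≠ (x.1, !x.2) ↔ (x.1 = y.1 → x.2 = y.2) := by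
  obtain ⟨a, s⟩ := x
  obtain ⟨b, t⟩ := y
  cases s <;> cases t <;> simp [eq_comm]

theorem consB_of_eq {x : B × Bool} {ξ : Boundary B} (h : ξ.1 0 = (x.1, !x.2)) (i : ℕ) :
    (consB B x ξ).1 i = ξ.1 (i + 1) := by
  simp [consB, h]

theorem consB_zero_of_ne {x : B × Bool} {ξ : Boundary B} (h : ξ.1 0 ≠ (x.1, !x.2)) :
    (consB B x ξ).1 0 = x := by
  simp [consB, h]

theorem consB_succ_of_ne {x : B × Bool} {ξ : Boundary B} (h : ξ.1 0 ≠ (x.1, !x.2)) (i : ℕ) :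
    (consB B x ξ).1 (i + 1) = ξ.1 i := by
  simp [consB, h]

theorem consB_consB_inv (x : B × Bool) (ξ : Boundary B) :
    consB B x (consB B (x.1, !x.2) ξ) = ξ := by
  apply Subtype.ext
  funext i
  by_cases h : ξ.1 0 = x
  · have h' : ξ.1 0 = ((x.1, !x.2).1, !(x.1, !x.2).2) := by simpa using h
    have h0 : (consB B (x.1, !x.2) ξ).1 0 ≠ (x.1, !x.2) := by
      rw [consB_of_eq h', ← h]
      exact ξ.2 0
    cases i with
    | zero => rw [consB_zero_of_ne h0, h]
    | succ i => rw [consB_succ_of_ne h0, consB_of_eq h']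
  · have h' : ξ.1 0 ≠ ((x.1, !x.2).1, !(x.1, !x.2).2) := by simpa using h
    rw [consB_of_eq (consB_zero_of_ne h'), consB_succ_of_ne h']

/-- Prepending a letter, as a permutation of the boundary. -/
def consPerm (x : B × Bool) : Equiv.Perm (Boundary B) where
  toFun := consB B x
  invFun := consB B (x.1, !x.2)
  left_inv ξ := by simpa using consB_consB_inv (x.1, !x.2) ξ
  right_inv := consB_consB_inv x

/-- The action of the free group on its boundary, as a homomorphism to permutations. -/
def boundaryPerm : FreeGroup B →* Equiv.Perm (Boundary B) :=
  FreeGroup.lift fun b => consPerm (b, true)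

theorem boundaryPerm_mk (L : List (B × Bool)) (ξ : Boundary B) :
    boundaryPerm (FreeGroup.mk L) ξ = L.foldr (consB B) ξ := by
  induction L with
  | nil => rfl
  | cons x L ih =>
    obtain ⟨b, s⟩ := x
    rw [boundaryPerm, FreeGroup.lift_mk] at ih ⊢
    rw [List.map_cons, List.prod_cons, Equiv.Perm.mul_apply, ih]
    cases s <;> rfl

theorem actB_eq_boundaryPerm (g : FreeGroup B) (ξ : Boundary B) :
    actB B g ξ = boundaryPerm g ξ := by
  rw [actB, ← boundaryPerm_mk, FreeGroup.mk_toWord]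

theorem actB_mul (g h : FreeGroup B) (ξ : Boundary B) :
    actB B (g * h) ξ = actB B g (actB B h ξ) := by
  simp only [actB_eq_boundaryPerm, map_mul, Equiv.Perm.mul_apply]

theorem actB_mk (L : List (B × Bool)) (ξ : Boundary B) :
    actB B (FreeGroup.mk L) ξ = L.foldr (consB B) ξ := by
  rw [actB_eq_boundaryPerm, boundaryPerm_mk]

theorem actB_inv_actB (g : FreeGroup B) (ξ : Boundary B) :
    actB B g (actB B g⁻¹ ξ) = ξ := by
  simp [actB_eq_boundaryPerm]

/-- A reduced word followed by an infinite word, without cancellation, is their concatenation. -/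
theorem foldr_consB_of_getLast? {l : List (B × Bool)} (hl : FreeGroup.IsReduced l)
    {ξ : Boundary B} (h : ∀ y ∈ l.getLast?, ξ.1 0 ≠ (y.1, !y.2)) :
    (∀ i (hi : i < l.length), (l.foldr (consB B) ξ).1 i = l[i]) ∧
      ∀ i, (l.foldr (consB B) ξ).1 (l.length + i) = ξ.1 i := by
  induction l with
  | nil => simp
  | cons x l ih =>
    have hne : (l.foldr (consB B) ξ).1 0 ≠ (x.1, !x.2) := by
      cases l with
      | nil => exact h x (by simp)
      | cons y l =>
        rw [FreeGroup.isReduced_cons_cons] at hl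
        rw [(ih hl.2 (by simpa using h)).1 0 (by simp)]
        exact ne_flip_iff.2 hl.1
    have ih' := ih (hl.infix (List.suffix_cons x l).isInfix) (by
      cases l with
      | nil => simp
      | cons y l => simpa using h)
    refine ⟨fun i hi => ?_, fun i => ?_⟩
    · cases i with
      | zero => exact consB_zero_of_ne hne
      | succ i =>
        simp only [List.foldr_cons, List.getElem_cons_succ]
        rw [consB_succ_of_ne hne, ih'.1]
    · rw [List.length_cons, Nat.add_right_comm]
      exact (consB_succ_of_ne hne _).trans (ih'.2 i)

/-- If two infinite words agree up to length `m + R` and their common prefix of length `m` is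
not a prefix of the reduced word `l`, then their translates by `l⁻¹` agree up to length `R`. -/
theorem foldr_invRev_agree {l : List (B × Bool)} (hl : FreeGroup.IsReduced l) {R : ℕ} :
    ∀ {m : ℕ} {ζ ζ' : Boundary B}, (∃ i < m, l[i]? ≠ some (ζ.1 i)) →
      (∀ i < m + R, ζ.1 i = ζ'.1 i) → ∀ i < R,
        ((FreeGroup.invRev l).foldr (consB B) ζ).1 i =
          ((FreeGroup.invRev l).foldr (consB B) ζ').1 i := by
  induction l with
  | nil =>
    intro m ζ ζ' _ h i hi
    exact h i (by omega)
  | cons x l ih =>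
    intro m ζ ζ' hm h i hi
    obtain ⟨j, hj, hjne⟩ := hm
    have hl' : FreeGroup.IsReduced l := hl.infix (List.suffix_cons x l).isInfix
    have key : ∀ η : Boundary B, (FreeGroup.invRev (x :: l)).foldr (consB B) η =
        (FreeGroup.invRev l).foldr (consB B) (consB B (x.1, !x.2) η) := by
      intro η
      rw [FreeGroup.invRev_cons, List.foldr_append]
      rfl
    rw [key, key]
    have h0 : ζ.1 0 = ζ'.1 0 := h 0 (by omega)
    by_cases hx : ζ.1 0 = x
    · have e : ζ.1 0 = ((x.1, !x.2).1, !(x.1, !x.2).2) := by simpa using hx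
      have e' : ζ'.1 0 = ((x.1, !x.2).1, !(x.1, !x.2).2) := by rw [← h0]; exact e
      obtain _ | j := j
      · simp [hx] at hjne
      · obtain _ | m := m
        · omega
        · refine ih hl' (m := m) ⟨j, by omega, ?_⟩ (fun i hi => ?_) i hi
          · rw [consB_of_eq e]
            simpa using hjne
          · rw [consB_of_eq e, consB_of_eq e']
            exact h _ (by omega)
    · have e : ζ.1 0 ≠ ((x.1, !x.2).1, !(x.1, !x.2).2) := by simpa using hx
      have e' : ζ'.1 0 ≠ ((x.1, !x.2).1, !(x.1, !x.2).2) := by rw [← h0]; exact e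
      refine ih hl' (m := m + 1) ⟨0, by omega, ?_⟩ (fun i hi => ?_) i hi
      · rw [consB_zero_of_ne e]
        cases l with
        | nil => simp
        | cons y l =>
          rw [FreeGroup.isReduced_cons_cons] at hl
          simpa using ne_flip_iff.2 hl.1
      · cases i with
        | zero => rw [consB_zero_of_ne e, consB_zero_of_ne e']
        | succ i =>
          rw [consB_succ_of_ne e, consB_succ_of_ne e']
          exact h _ (by omega)

theorem actB_inv_agree {h : FreeGroup B} {R m : ℕ} {ζ ζ' : Boundary B}
    (hm : ∃ i < m, h.toWord[i]? ≠ some (ζ.1 i)) (hζ : ∀ i < m + R, ζ.1 i = ζ'.1 i) :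
    ∀ i < R, (actB B h⁻¹ ζ).1 i = (actB B h⁻¹ ζ').1 i := by
  simp only [actB, FreeGroup.toWord_inv]
  exact foldr_invRev_agree FreeGroup.isReduced_toWord hm hζ

/-- If `v` does not cancel against `ξ` and is not a prefix of `h`, then the first letters of
`h⁻¹ * v * ξ` are determined by those of `ξ`. -/
theorem actB_agree_of_not_prefix {v h : FreeGroup B} (hv : ¬ v.toWord <+: h.toWord) {R : ℕ}
    {ξ ξ' : Boundary B} (hR : ∀ i < R + 1, ξ.1 i = ξ'.1 i)
    (hξ : ∀ y ∈ v.toWord.getLast?, ξ.1 0 ≠ (y.1, !y.2)) :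
    ∀ i < R, (actB B h⁻¹ (actB B v ξ)).1 i = (actB B h⁻¹ (actB B v ξ')).1 i := by
  obtain ⟨h1, h2⟩ := foldr_consB_of_getLast? (FreeGroup.isReduced_toWord (x := v)) hξ
  obtain ⟨h1', h2'⟩ := foldr_consB_of_getLast? (FreeGroup.isReduced_toWord (x := v)) (ξ := ξ')
    (by rw [← hR 0 (by omega)]; exact hξ)
  refine actB_inv_agree (m := v.toWord.length) ?_ fun i hi => ?_
  · rw [List.prefix_iff_getElem?] at hv
    push Not at hv
    obtain ⟨i, hi, hne⟩ := hv
    exact ⟨i, hi, by rw [actB, h1 i hi]; exact hne⟩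
  · by_cases hlt : i < v.toWord.length
    · rw [actB, actB, h1 i hlt, h1' i hlt]
    · obtain ⟨j, rfl⟩ := Nat.exists_eq_add_of_le (not_lt.1 hlt)
      rw [actB, actB, h2, h2', hR j (by omega)]

/-- If `v` cancels against `ξ` and is a prefix of `h`, then the first letters of
`h⁻¹ * v * ξ` are determined by those of `ξ`. -/
theorem actB_agree_of_prefix {v h : FreeGroup B} (hv : v.toWord <+: h.toWord) {R : ℕ}
    {ξ ξ' : Boundary B} (hR : ∀ i < R + 1, ξ.1 i = ξ'.1 i)
    (hξ : ∃ y ∈ v.toWord.getLast?, ξ.1 0 = (y.1, !y.2)) :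
    ∀ i < R, (actB B h⁻¹ (actB B v ξ)).1 i = (actB B h⁻¹ (actB B v ξ')).1 i := by
  obtain ⟨u, hu⟩ := hv
  have hred : FreeGroup.IsReduced (v.toWord ++ u) := hu ▸ FreeGroup.isReduced_toWord
  have hured : FreeGroup.IsReduced u := hred.infix (List.suffix_append _ _).isInfix
  have hhu : h = v * FreeGroup.mk u := by
    rw [← FreeGroup.mk_toWord (x := h), ← hu, ← FreeGroup.mul_mk, FreeGroup.mk_toWord]
  simp only [← actB_mul]
  rw [show h⁻¹ * v = (FreeGroup.mk u)⁻¹ by rw [hhu]; group]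
  refine actB_inv_agree (m := 1) ⟨0, by omega, ?_⟩ (fun i hi => hR i (by omega))
  rw [FreeGroup.toWord_mk, hured.reduce_eq]
  obtain ⟨y, hy, hy0⟩ := hξ
  cases u with
  | nil => simp
  | cons a u =>
    have := (List.isChain_append.1 hred).2.2 y hy a (by simp)
    have := ne_flip_iff.2 this
    rw [hy0]
    simpa using this

end Words

section Lines

theorem toWord_mk_singleton_mul (x : B × Bool) (a : FreeGroup B) :
    (FreeGroup.mk [x] * a).toWord = FreeGroup.reduce (x :: a.toWord) := by
  rw [← FreeGroup.mk_toWord (x := a), FreeGroup.mul_mk, FreeGroup.toWord_mk, FreeGroup.mk_toWord]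
  rfl

theorem TendstoBoundary.mk_singleton_mul {a : ℕ → FreeGroup B} {ξ : Boundary B}
    (h : TendstoBoundary B a ξ) (x : B × Bool) :
    TendstoBoundary B (fun k => FreeGroup.mk [x] * a k) (consB B x ξ) := by
  intro m
  obtain ⟨K, hK⟩ := h (m + 1)
  refine ⟨K, fun k hk => ?_⟩
  have hp := hK k hk
  simp only [toWord_mk_singleton_mul]
  have hred : FreeGroup.reduce (a k).toWord = (a k).toWord := FreeGroup.reduce_toWord _
  rw [List.ofFn_succ] at hp
  obtain ⟨t, ht⟩ := hp
  rw [FreeGroup.reduce.cons, hred, ← ht]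
  simp only [List.cons_append]
  by_cases hx : ξ.1 0 = (x.1, !x.2)
  · rw [if_pos (by simp [hx])]
    simp only [consB_of_eq hx]
    exact List.prefix_append _ _
  · rw [if_neg (by
      rintro ⟨h1, h2⟩
      apply hx
      ext
      · simpa using h1.symm
      · simp [h2])]
    cases m with
    | zero => simp
    | succ m =>
      rw [List.ofFn_succ]
      simp only [Fin.val_zero, Fin.val_succ, consB_zero_of_ne hx, consB_succ_of_ne hx]
      have e : (ξ.1 0 :: List.ofFn fun i : Fin (m + 1) => ξ.1 (i + 1)) =
          List.ofFn fun i : Fin (m + 2) => ξ.1 i := by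
        rw [List.ofFn_succ (n := m + 1)]
        rfl
      rw [List.prefix_cons_inj, ← List.cons_append, e, List.ofFn_succ' (n := m + 1),
        List.ofFn_succ' (n := m), List.concat_eq_append, List.concat_eq_append,
        List.append_assoc, List.append_assoc]
      exact List.prefix_append _ _

theorem TendstoBoundary.mul {a : ℕ → FreeGroup B} {ξ : Boundary B}
    (h : TendstoBoundary B a ξ) (g : FreeGroup B) :
    TendstoBoundary B (fun k => g * a k) (actB B g ξ) := by
  rw [actB]
  have key : ∀ L : List (B × Bool),
      TendstoBoundary B (fun k => FreeGroup.mk L * a k) (L.foldr (consB B) ξ) := by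
    intro L
    induction L with
    | nil => simpa [← FreeGroup.one_eq_mk] using h
    | cons x L ih =>
      have := ih.mk_singleton_mul x
      simp only [← mul_assoc, FreeGroup.mul_mk] at this
      exact this
  simpa [FreeGroup.mk_toWord] using key g.toWord

variable {r : ℕ} {w : Fin r → FreeGroup B}

theorem IsLine.actB {ξ η : Boundary B} (h : IsLine B w ξ η) (g : FreeGroup B) :
    IsLine B w (actB B g ξ) (actB B g η) := by
  obtain ⟨a, i, h⟩ := h
  refine ⟨g * a, i, ?_⟩
  simp only [mul_assoc]
  exact h.imp (fun h => ⟨h.1.mul g, h.2.mul g⟩) (fun h => ⟨h.1.mul g, h.2.mul g⟩)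

theorem actD_qmap (g : FreeGroup B) (ξ : Boundary B) :
    actD B w g (qmap B w ξ) = qmap B w (actB B g ξ) := by
  have key : ∀ d, actD B w g d = Quot.map (DecompPaper.actB B g) (fun _ _ h => h.actB g) d := by
    intro d
    conv_rhs => rw [← Quot.out_eq d]
    rfl
  rw [key]
  rfl

end Lines

section Trees

theorem toWord_prefixOf (ξ : Boundary B) (m : ℕ) :
    (prefixOf B ξ m).toWord = List.ofFn fun i : Fin m => ξ.1 i := by
  rw [prefixOf, FreeGroup.toWord_mk]
  refine FreeGroup.IsReduced.reduce_eq ?_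
  rw [FreeGroup.IsReduced, List.isChain_iff_getElem]
  intro i hi
  simp only [List.getElem_ofFn]
  exact ne_flip_iff.1 (ξ.2 i)

theorem prefixOf_succ {A : Type} (ξ : Boundary A) (m : ℕ) :
    prefixOf A ξ (m + 1) = prefixOf A ξ m * FreeGroup.mk [ξ.1 m] := by
  rw [prefixOf, prefixOf, FreeGroup.mul_mk, List.ofFn_succ']
  simp [List.concat_eq_append]

/-- A function supported on a subtree within distance less than `R` of the identity depends only
on the first `R` letters. -/
theorem SupportedOn.eq_of_agree {r : ℕ} {w : Fin r → FreeGroup B} {σ : DSpace B w → ℤ}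
    {X : Set (FreeGroup B)} (hσ : SupportedOn B w σ X) {R : ℕ} (hR : ∀ a ∈ X, a.norm < R)
    {ξ η : Boundary B} (h : ∀ i < R, ξ.1 i = η.1 i) :
    σ (qmap B w ξ) = σ (qmap B w η) := by
  have hout : ∀ (ζ : Boundary B) (m : ℕ), R ≤ m → prefixOf B ζ m ∉ X := by
    intro ζ m hm hX
    have := hR _ hX
    rw [FreeGroup.norm, toWord_prefixOf, List.length_ofFn] at this
    omega
  have hmem : ∀ ζ : Boundary B, ζ ∈ boundaryOf B {u | Relation.ReflTransGen
      (fun a b => Adj B a b ∧ a ∉ X ∧ b ∉ X) (prefixOf B ζ R) u} := by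
    intro ζ
    refine ⟨R, fun m hm => ?_⟩
    induction m, hm using Nat.le_induction with
    | base => exact Relation.ReflTransGen.refl
    | succ m hm ih =>
      exact Relation.ReflTransGen.tail ih
        ⟨⟨_, prefixOf_succ ζ m⟩, hout ζ m hm, hout ζ (m + 1) (by omega)⟩
  have hpre : prefixOf B ξ R = prefixOf B η R := by
    rw [prefixOf, prefixOf]
    congr 2
    funext i
    exact h i i.2
  refine hσ _ ⟨prefixOf B ξ R, hout ξ R le_rfl, rfl⟩ ξ (hmem ξ) η ?_
  rw [hpre]
  exact hmem η

theorem Adj.symm {A : Type} {a b : FreeGroup A} (h : Adj A a b) : Adj A b a := by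
  obtain ⟨x, rfl⟩ := h
  refine ⟨(x.1, !x.2), ?_⟩
  rw [show FreeGroup.mk [(x.1, !x.2)] = (FreeGroup.mk [x])⁻¹ from rfl,
    mul_inv_cancel_right]

theorem isSubtree_ball (v : FreeGroup B) (K : ℕ) :
    IsSubtree B {g | (v⁻¹ * g).norm ≤ K} := by
  have key : ∀ L : List (B × Bool), L.length ≤ K →
      Relation.ReflTransGen (fun a b => Adj B a b ∧ b ∈ {g | (v⁻¹ * g).norm ≤ K})
        v (v * FreeGroup.mk L) ∧
      Relation.ReflTransGen (fun a b => Adj B a b ∧ b ∈ {g | (v⁻¹ * g).norm ≤ K})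
        (v * FreeGroup.mk L) v := by
    intro L
    induction L using List.reverseRecOn with
    | nil =>
      intro _
      rw [← FreeGroup.one_eq_mk, mul_one]
      exact ⟨.refl, .refl⟩
    | append_singleton L x ih =>
      intro hL
      simp only [List.length_append, List.length_singleton] at hL
      obtain ⟨h1, h2⟩ := ih (by omega)
      have hadj : Adj B (v * FreeGroup.mk L) (v * FreeGroup.mk (L ++ [x])) :=
        ⟨x, by rw [mul_assoc, FreeGroup.mul_mk]⟩
      refine ⟨h1.tail ⟨hadj, ?_⟩, .head ⟨hadj.symm, ?_⟩ h2⟩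
      · simp only [Set.mem_ofPred_eq, inv_mul_cancel_left]
        exact FreeGroup.norm_mk_le.trans (by simpa using hL)
      · simp only [Set.mem_ofPred_eq, inv_mul_cancel_left]
        exact FreeGroup.norm_mk_le.trans (by omega)
  intro g hg h hh
  have hg' := (key _ hg).2
  have hh' := (key _ hh).1
  rw [FreeGroup.mk_toWord, mul_inv_cancel_left] at hg' hh'
  exact hg'.trans hh'

theorem finite_norm_le [Finite B] (K : ℕ) : {g : FreeGroup B | g.norm ≤ K}.Finite := by
  refine Set.Finite.of_finite_image (f := FreeGroup.toWord)
    ((List.finite_length_le (B × Bool) K).subset ?_) FreeGroup.toWord_injective.injOn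
  rintro _ ⟨g, hg, rfl⟩
  exact hg

/-- An element of the free module whose group elements are near `v` has small support. -/
theorem ncard_fsSupport_le [Finite B] {k : ℕ} {X : Fin k → Set (FreeGroup B)} {R : ℕ}
    (hR : ∀ j, ∀ a ∈ X j, a.norm < R) {y : (Fin k × FreeGroup B) →₀ ℤ} {v : FreeGroup B}
    {K : ℕ} (hy : ∀ p ∈ y.support, (v⁻¹ * p.2⁻¹).norm ≤ K) :
    (fsSupport B X y).ncard ≤ {g : FreeGroup B | g.norm ≤ K + R}.ncard := by
  have hsub : fsSupport B X y ⊆ {g | (v⁻¹ * g).norm ≤ K + R} := by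
    refine Set.sInter_subset_of_mem ⟨isSubtree_ball v (K + R), ?_⟩
    simp only [Set.iUnion_subset_iff, Set.image_subset_iff]
    intro p hp a ha
    have h1 := hy p hp
    have h2 := hR _ a ha
    have h3 := FreeGroup.norm_mul_le (v⁻¹ * p.2⁻¹) a
    simp only [Set.mem_preimage, Set.mem_ofPred_eq, ← mul_assoc]
    omega
  have himg : (fun g => v⁻¹ * g) '' fsSupport B X y ⊆ {g | g.norm ≤ K + R} := by
    rintro _ ⟨g, hg, rfl⟩
    exact hsub hg
  rw [← Set.ncard_image_of_injective _ (mul_right_injective v⁻¹)]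
  exact Set.ncard_le_ncard himg (finite_norm_le _)

end Trees

section Module

variable {r : ℕ} (w : Fin r → FreeGroup B)

/-- The map `pMap` composed with pulling back functions along `q`, as a linear map. -/
noncomputable def pLin {k : ℕ} (σ : Fin k → DSpace B w → ℤ) :
    ((Fin k × FreeGroup B) →₀ ℤ) →ₗ[ℤ] Boundary B → ℤ :=
  Finsupp.linearCombination ℤ fun p ξ => σ p.1 (qmap B w (actB B p.2 ξ))

/-- Functions on the boundary that agree on the endpoints of every line and depend only on the
first `R` letters. -/
def localFunctions (R : ℕ) : Submodule ℤ (Boundary B → ℤ) where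
  carrier := {f | (∀ ξ η, IsLine B w ξ η → f ξ = f η) ∧
    ∀ ξ η : Boundary B, (∀ i < R, ξ.1 i = η.1 i) → f ξ = f η}
  add_mem' hf hg := ⟨fun ξ η h => congrArg₂ (· + ·) (hf.1 ξ η h) (hg.1 ξ η h),
    fun ξ η h => congrArg₂ (· + ·) (hf.2 ξ η h) (hg.2 ξ η h)⟩
  zero_mem' := ⟨fun _ _ _ => rfl, fun _ _ _ => rfl⟩
  smul_mem' c _ hf := ⟨fun ξ η h => congrArg (c • ·) (hf.1 ξ η h),
    fun ξ η h => congrArg (c • ·) (hf.2 ξ η h)⟩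

variable {w}

theorem localFunctions_fg [Finite B] (R : ℕ) : (localFunctions w R).FG := by
  let φ : ((Fin R → B × Bool) → ℤ) →ₗ[ℤ] Boundary B → ℤ :=
    LinearMap.funLeft ℤ ℤ fun (ξ : Boundary B) (i : Fin R) => ξ.1 i
  have hle : localFunctions w R ≤ LinearMap.range φ := by
    intro f hf
    refine ⟨Function.extend (fun (ξ : Boundary B) (i : Fin R) => ξ.1 i) f 0, ?_⟩
    funext ξ
    refine Function.FactorsThrough.extend_apply (fun a b hab => hf.2 a b fun i hi => ?_) _ ξ
    exact congrFun hab ⟨i, hi⟩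
  have : IsNoetherian ℤ (localFunctions w R) := isNoetherian_of_le hle
  exact (isNoetherian_submodule.1 this) _ le_rfl

theorem continuous_of_comp_qmap_mem {τ : DSpace B w → ℤ} {R : ℕ}
    (h : τ ∘ qmap B w ∈ localFunctions w R) : Continuous τ := by
  refine isQuotientMap_quot_mk.continuous_iff.2 ?_
  refine IsLocallyConstant.continuous ((IsLocallyConstant.iff_exists_open _).2 fun ξ => ?_)
  have : DiscreteTopology (B × Bool) := ⟨rfl⟩
  refine ⟨(fun (η : Boundary B) (i : Fin R) => η.1 i) ⁻¹' {fun i : Fin R => ξ.1 i},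
    (isOpen_discrete _).preimage
      (continuous_pi fun i => (continuous_apply i.1).comp continuous_subtype_val), rfl, fun η hη => ?_⟩
  exact h.2 η ξ fun i hi => congrFun hη ⟨i, hi⟩

variable {k : ℕ} {σ : Fin k → DSpace B w → ℤ}

theorem pLin_apply (x : (Fin k × FreeGroup B) →₀ ℤ) (ξ : Boundary B) :
    pLin w σ x ξ = x.sum fun p n => n * σ p.1 (qmap B w (actB B p.2 ξ)) := by
  simp [pLin, Finsupp.linearCombination_apply, Finsupp.sum, Finset.sum_apply]

theorem pMap_qmap (x : (Fin k × FreeGroup B) →₀ ℤ) (ξ : Boundary B) :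
    pMap B w σ x (qmap B w ξ) = pLin w σ x ξ := by
  simp only [pMap, pLin_apply, actD_qmap]

theorem pMap_eq_zero_iff (x : (Fin k × FreeGroup B) →₀ ℤ) :
    pMap B w σ x = 0 ↔ pLin w σ x = 0 := by
  refine ⟨fun h => funext fun ξ => ?_, fun h => funext fun d => ?_⟩
  · rw [← pMap_qmap, h]
    rfl
  · obtain ⟨ξ, rfl⟩ := Quot.exists_rep d
    exact (pMap_qmap x ξ).trans (congrFun h ξ)

theorem pLin_fsTranslate (x : (Fin k × FreeGroup B) →₀ ℤ) (g : FreeGroup B) (ξ : Boundary B) :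
    pLin w σ (fsTranslate B x g) ξ = pLin w σ x (actB B g ξ) := by
  rw [pLin_apply, pLin_apply, fsTranslate, Finsupp.sum_mapDomain_index (by simp)
    (by intros; ring)]
  simp only [actB_mul]

theorem pLin_eq_of_isLine (x : (Fin k × FreeGroup B) →₀ ℤ) {ξ η : Boundary B}
    (h : IsLine B w ξ η) : pLin w σ x ξ = pLin w σ x η := by
  rw [← pMap_qmap, ← pMap_qmap]
  exact congrArg _ (Quot.sound h)

theorem pLin_eq_of_forall {x : (Fin k × FreeGroup B) →₀ ℤ} {ξ η : Boundary B}
    (h : ∀ p ∈ x.support, σ p.1 (qmap B w (actB B p.2 ξ)) = σ p.1 (qmap B w (actB B p.2 η))) :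
    pLin w σ x ξ = pLin w σ x η := by
  rw [pLin_apply, pLin_apply]
  exact Finset.sum_congr rfl fun p hp => congrArg (x p * ·) (h p hp)

/-- The part of a kernel element lying beyond `v` has image determined by data near `v`. -/
theorem pLin_filter_mem_localFunctions {R : ℕ}
    (hσ : ∀ (j : Fin k) (ξ η : Boundary B), (∀ i < R, ξ.1 i = η.1 i) →
      σ j (qmap B w ξ) = σ j (qmap B w η))
    {x : (Fin k × FreeGroup B) →₀ ℤ} (hx : pLin w σ x = 0) (v : FreeGroup B) :
    (fun ξ => pLin w σ (x.filter fun p => v.toWord <+: p.2⁻¹.toWord) (actB B v ξ)) ∈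
      localFunctions w (R + 1) := by
  refine ⟨fun ξ η h => pLin_eq_of_isLine _ (h.actB v), fun ξ η h => ?_⟩
  by_cases hv : ∃ y ∈ v.toWord.getLast?, ξ.1 0 = (y.1, !y.2)
  · refine pLin_eq_of_forall fun p hp => hσ _ _ _ ?_
    rw [Finsupp.support_filter, Finset.mem_filter] at hp
    simpa using actB_agree_of_prefix hp.2 h hv
  · have hsplit : ∀ ζ, pLin w σ (x.filter fun p => v.toWord <+: p.2⁻¹.toWord) ζ =
        -pLin w σ (x.filter fun p => ¬ v.toWord <+: p.2⁻¹.toWord) ζ := by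
      intro ζ
      have h1 := congrArg (pLin w σ)
        (Finsupp.filter_add_filter_not x fun p => v.toWord <+: p.2⁻¹.toWord)
      rw [map_add, hx] at h1
      exact eq_neg_of_add_eq_zero_left (congrFun h1 ζ)
    refine (hsplit _).trans (Eq.trans (congrArg _ ?_) (hsplit _).symm)
    refine pLin_eq_of_forall fun p hp => hσ _ _ _ ?_
    rw [Finsupp.support_filter, Finset.mem_filter] at hp
    push Not at hv
    simpa using actB_agree_of_not_prefix hp.2 h hv

/-- All local functions are images of elements of the free module in a fixed ball. -/
theorem exists_localFunctions_le_map [Finite B]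
    (hgen : ∀ τ : DSpace B w → ℤ, Continuous τ →
      ∃ x : (Fin k × FreeGroup B) →₀ ℤ, pMap B w σ x = τ) (R : ℕ) :
    ∃ M : ℕ, localFunctions w R ≤
      (Finsupp.supported ℤ ℤ {p : Fin k × FreeGroup B | p.2.norm ≤ M}).map (pLin w σ) := by
  obtain ⟨S, hS⟩ := localFunctions_fg (w := w) R
  have hz : ∀ f : Boundary B → ℤ, ∃ z, f ∈ localFunctions w R → pLin w σ z = f := by
    intro f
    by_cases hf : f ∈ localFunctions w R
    · obtain ⟨z, hz⟩ := hgen (Quot.lift f hf.1) (continuous_of_comp_qmap_mem (R := R) hf)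
      refine ⟨z, fun _ => funext fun ξ => ?_⟩
      rw [← pMap_qmap, hz]
      rfl
    · exact ⟨0, fun h => absurd h hf⟩
  choose z hz using hz
  refine ⟨S.sup fun f => (z f).support.sup fun p => p.2.norm, ?_⟩
  rw [← hS, Submodule.span_le]
  intro f hf
  refine ⟨z f, ?_, hz f (hS ▸ Submodule.subset_span hf)⟩
  rw [SetLike.mem_coe, Finsupp.mem_supported]
  intro p hp
  exact (Finset.le_sup (f := fun p : Fin k × FreeGroup B => p.2.norm) hp).trans
    (Finset.le_sup (f := fun f => (z f).support.sup fun p => p.2.norm) hf)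

theorem exists_pLin_eq_filter {R M : ℕ}
    (hσ : ∀ (j : Fin k) (ξ η : Boundary B), (∀ i < R, ξ.1 i = η.1 i) →
      σ j (qmap B w ξ) = σ j (qmap B w η))
    (hM : localFunctions w (R + 1) ≤
      (Finsupp.supported ℤ ℤ {p : Fin k × FreeGroup B | p.2.norm ≤ M}).map (pLin w σ))
    {x : (Fin k × FreeGroup B) →₀ ℤ} (hx : pLin w σ x = 0) (v : FreeGroup B) :
    ∃ z : (Fin k × FreeGroup B) →₀ ℤ, (∀ p ∈ z.support, (v⁻¹ * p.2⁻¹).norm ≤ M) ∧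
      pLin w σ z = pLin w σ (x.filter fun p => v.toWord <+: p.2⁻¹.toWord) := by
  obtain ⟨z, hzs, hz⟩ := hM (pLin_filter_mem_localFunctions hσ hx v)
  refine ⟨fsTranslate B z v⁻¹, fun p hp => ?_, funext fun ξ => ?_⟩
  · obtain ⟨q, hq, rfl⟩ := Finset.mem_image.1 (Finsupp.mapDomain_support hp)
    have : q.2.norm ≤ M := (Finsupp.mem_supported _ _).1 hzs hq
    simpa [FreeGroup.norm_inv_eq] using this
  · rw [pLin_fsTranslate, hz]
    simp only [actB_inv_actB]

/-- A kernel element is, modulo kernel elements concentrated near single vertices, supported in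
a ball of bounded radius, and hence in the span of such elements. -/
theorem mem_span_of_pLin_eq_zero {R M : ℕ}
    (hσ : ∀ (j : Fin k) (ξ η : Boundary B), (∀ i < R, ξ.1 i = η.1 i) →
      σ j (qmap B w ξ) = σ j (qmap B w η))
    (hM : localFunctions w (R + 1) ≤
      (Finsupp.supported ℤ ℤ {p : Fin k × FreeGroup B | p.2.norm ≤ M}).map (pLin w σ))
    (L : ℕ) : ∀ x : (Fin k × FreeGroup B) →₀ ℤ, pLin w σ x = 0 →
      (∀ p ∈ x.support, p.2.norm ≤ L) →
      x ∈ Submodule.span ℤ {y | pLin w σ y = 0 ∧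
        ∃ v : FreeGroup B, ∀ p ∈ y.support, (v⁻¹ * p.2⁻¹).norm ≤ M + 1} := by
  induction L with
  | zero =>
    intro x hx hL
    refine Submodule.subset_span ⟨hx, 1, fun p hp => ?_⟩
    have := hL p hp
    simp only [inv_one, one_mul, FreeGroup.norm_inv_eq]
    omega
  | succ L ih =>
    intro x hx hL
    by_cases hLM : L < M
    · refine Submodule.subset_span ⟨hx, 1, fun p hp => ?_⟩
      have := hL p hp
      simp only [inv_one, one_mul, FreeGroup.norm_inv_eq]
      omega
    obtain ⟨l, rfl⟩ := Nat.exists_eq_add_of_le (not_lt.1 hLM)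
    choose z hzs hz using exists_pLin_eq_filter hσ hM hx
    let c : Fin k × FreeGroup B → FreeGroup B := fun p => FreeGroup.mk (p.2⁻¹.toWord.take l)
    have hc : ∀ p, (c p).toWord = p.2⁻¹.toWord.take l := fun p => by
      rw [FreeGroup.toWord_mk]
      exact (FreeGroup.isReduced_toWord.infix (List.take_prefix _ _).isInfix).reduce_eq
    have hlen : ∀ p : Fin k × FreeGroup B, p.2⁻¹.toWord.length = p.2.norm := fun p =>
      FreeGroup.norm_inv_eq
    let S := (x.support.filter fun p => p.2.norm = M + l + 1).image c
    have hSlen : ∀ v ∈ S, v.toWord.length = l := by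
      intro v hv
      obtain ⟨p, hp, rfl⟩ := Finset.mem_image.1 hv
      rw [hc, List.length_take, hlen, (Finset.mem_filter.1 hp).2]
      omega
    let t : FreeGroup B → (Fin k × FreeGroup B) →₀ ℤ := fun v =>
      (x.filter fun p => v.toWord <+: p.2⁻¹.toWord) - z v
    have htker : ∀ v, pLin w σ (t v) = 0 := fun v => by
      simp only [t, map_sub, hz, sub_self]
    have htmem : ∀ v ∈ S, t v ∈ Submodule.span ℤ {y | pLin w σ y = 0 ∧
        ∃ v : FreeGroup B, ∀ p ∈ y.support, (v⁻¹ * p.2⁻¹).norm ≤ M + 1} := by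
      intro v hv
      refine Submodule.subset_span ⟨htker v, v, fun p hp => ?_⟩
      rcases Finset.mem_union.1 (Finsupp.support_sub hp) with hp | hp
      · rw [Finsupp.support_filter, Finset.mem_filter] at hp
        obtain ⟨hp, u, hu⟩ := hp
        have e : v⁻¹ * p.2⁻¹ = FreeGroup.mk u := by
          rw [← FreeGroup.mk_toWord (x := p.2⁻¹), ← hu, ← FreeGroup.mul_mk, FreeGroup.mk_toWord,
            inv_mul_cancel_left]
        have h1 := congrArg List.length hu
        rw [List.length_append, hSlen v hv, hlen] at h1
        have h2 := hL p hp
        rw [e]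
        exact FreeGroup.norm_mk_le.trans (by omega)
      · exact (hzs v p hp).trans (Nat.le_succ M)
    have hrest : x - ∑ v ∈ S, t v ∈ Submodule.span ℤ {y | pLin w σ y = 0 ∧
        ∃ v : FreeGroup B, ∀ p ∈ y.support, (v⁻¹ * p.2⁻¹).norm ≤ M + 1} := by
      refine ih _ (by simp [hx, htker]) fun p hp => ?_
      by_contra hlt
      refine Finsupp.mem_support_iff.1 hp ?_
      have hz0 : ∀ v ∈ S, z v p = 0 := by
        intro v hv
        by_contra hne
        have h1 := hzs v p (Finsupp.mem_support_iff.2 hne)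
        have h2 := FreeGroup.norm_mul_le v (v⁻¹ * p.2⁻¹)
        rw [mul_inv_cancel_left, FreeGroup.norm_inv_eq] at h2
        have h3 : v.norm = l := hSlen v hv
        omega
      rw [Finsupp.sub_apply, Finsupp.finsetSum_apply, sub_eq_zero]
      by_cases hxp : x p = 0
      · rw [hxp, Finset.sum_eq_zero]
        intro v hv
        simp [t, hz0 v hv, Finsupp.filter_apply, hxp]
      · have hps : p ∈ x.support := Finsupp.mem_support_iff.2 hxp
        have hpn : p.2.norm = M + l + 1 := by
          have := hL p hps
          omega
        rw [Finset.sum_eq_single (c p)]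
        · have hcp : c p ∈ S :=
            Finset.mem_image_of_mem c (Finset.mem_filter.2 ⟨hps, hpn⟩)
          simp only [t, Finsupp.sub_apply, hz0 _ hcp, sub_zero]
          rw [Finsupp.filter_apply_pos]
          rw [hc]
          exact List.take_prefix _ _
        · intro v hv hne
          simp only [t, Finsupp.sub_apply, hz0 v hv, sub_zero]
          rw [Finsupp.filter_apply_neg]
          intro hpre
          apply hne
          rw [← FreeGroup.toWord_inj, hc, ← hSlen v hv]
          exact List.prefix_iff_eq_take.1 hpre
        · intro hcp
          exact absurd (Finset.mem_image_of_mem c (Finset.mem_filter.2 ⟨hps, hpn⟩)) hcp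
    have := Submodule.add_mem _ hrest (Submodule.sum_mem _ htmem)
    rwa [sub_add_cancel] at this

end Module

end DecompPaper


open DecompPaper
/-- Theorem `relators0`: given continuous generators `σ j` of the
right `ℤ[F]`-module `C(D, ℤ)`, supported on finite nonempty subtrees `X j`, there is
`N` such that the kernel of the induced map `p : (ℤ[F])^k → C(D, ℤ)` is generated as
an abelian group by elements whose support has at most `N` vertices. -/
theorem kernel_generated_by_bounded_support
    (B : Type) [Fintype B] [DecidableEq B] (hB : 2 ≤ Fintype.card B)
    (r : ℕ) (w : Fin r → FreeGroup B) (hw : ∀ i, w i ≠ 1) (hmal : Malnormal B w)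
    (k : ℕ) (σ : Fin k → DSpace B w → ℤ) (hσ : ∀ j, Continuous (σ j))
    (hgen : ∀ τ : DSpace B w → ℤ, Continuous τ →
      ∃ x : (Fin k × FreeGroup B) →₀ ℤ, pMap B w σ x = τ)
    (X : Fin k → Set (FreeGroup B))
    (hXfin : ∀ j, (X j).Finite) (hXne : ∀ j, (X j).Nonempty)
    (hXtree : ∀ j, IsSubtree B (X j))
    (hXsupp : ∀ j, SupportedOn B w (σ j) (X j)) :
    ∃ N : ℕ, ∀ x : (Fin k × FreeGroup B) →₀ ℤ, pMap B w σ x = 0 →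
      ∃ (m : ℕ) (c : Fin m → ℤ) (y : Fin m → (Fin k × FreeGroup B) →₀ ℤ),
        (∀ i, pMap B w σ (y i) = 0) ∧
        (∀ i, (fsSupport B X (y i)).ncard ≤ N) ∧
        x = ∑ i, c i • y i := by
  obtain ⟨R, hR⟩ : ∃ R : ℕ, ∀ j, ∀ a ∈ X j, a.norm < R := by
    have hfin : (⋃ j, X j).Finite := Set.finite_iUnion hXfin
    obtain ⟨R, hR⟩ := (hfin.image FreeGroup.norm).bddAbove
    exact ⟨R + 1, fun j a ha => Nat.lt_succ_of_le (hR ⟨a, Set.mem_iUnion.2 ⟨j, ha⟩, rfl⟩)⟩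
  have hloc : ∀ (j : Fin k) (ξ η : Boundary B), (∀ i < R, ξ.1 i = η.1 i) →
      σ j (qmap B w ξ) = σ j (qmap B w η) :=
    fun j ξ η h => (hXsupp j).eq_of_agree (hR j) h
  obtain ⟨M, hM⟩ := exists_localFunctions_le_map hgen (R + 1)
  refine ⟨{g : FreeGroup B | g.norm ≤ M + 1 + R}.ncard, fun x hx => ?_⟩
  have hmem := mem_span_of_pLin_eq_zero hloc hM (x.support.sup fun p => p.2.norm) x
    ((pMap_eq_zero_iff x).1 hx) fun p hp =>
      Finset.le_sup (f := fun p : Fin k × FreeGroup B => p.2.norm) hp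
  obtain ⟨m, c, y, hy⟩ := Submodule.mem_span_set'.1 hmem
  refine ⟨m, c, fun i => y i, fun i => (pMap_eq_zero_iff _).2 (y i).2.1, fun i => ?_, hy.symm⟩
  obtain ⟨v, hv⟩ := (y i).2.2
  exact ncard_fsSupport_le hR hv
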